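/- Let h:ℝ²→ℝ be of the form h(x₁,x₂) = φ₁(x₁) + φ₂(x₂), where φ₁, φ₂:ℝ→ℝ are monotone in the same direction (both increasing or both decreasing). Then for any two vectors x, y ∈ ℝⁿ, (h(x_[1],y_[n]),…,h(x_[n],y_[1])) ≺ (h(x₁,y₁),…,h(x_n,y_n)), i.e. the rearranged vector is (strongly) majorized by the original. -/

import Mathlib

/-- Decreasing rearrangement of a vector. -/
noncomputable def decSort {n : ℕ} (x : Fin n → ℝ) : Fin n → ℝ :=
  fun i => x (Tuple.sort x i.rev)

/-- Increasing rearrangement of a vector. -/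
noncomputable def incSort {n : ℕ} (x : Fin n → ℝ) : Fin n → ℝ :=
  fun i => x (Tuple.sort x i)

/-- Sum of the `k` largest components. -/
noncomputable def topSum {n : ℕ} (k : ℕ) (x : Fin n → ℝ) : ℝ :=
  ∑ i ∈ Finset.univ.filter (fun i : Fin n => (i : ℕ) < k), decSort x i

/-- Sum of the `k` smallest components. -/
noncomputable def botSum {n : ℕ} (k : ℕ) (x : Fin n → ℝ) : ℝ :=
  ∑ i ∈ Finset.univ.filter (fun i : Fin n => (i : ℕ) < k), incSort x i

/-- `x ≺ y` : majorization. -/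
def Maj {n : ℕ} (x y : Fin n → ℝ) : Prop :=
  (∀ k < n, topSum k x ≤ topSum k y) ∧ (∑ i, x i = ∑ i, y i)

/-- `x ≺_w y` : weak submajorization. -/
def WSubMaj {n : ℕ} (x y : Fin n → ℝ) : Prop :=
  ∀ k ≤ n, topSum k x ≤ topSum k y

/-- `x ≺^w y` : weak supermajorization. -/
def WSupMaj {n : ℕ} (x y : Fin n → ℝ) : Prop :=
  ∀ k ≤ n, botSum k y ≤ botSum k x

/-- Schur-convexity. -/
def SchurConvex {n : ℕ} (φ : (Fin n → ℝ) → ℝ) : Prop :=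
  ∀ x y, Maj x y → φ x ≤ φ y

/-- `Y` is obtained from `X` by permuting the entries within each column. -/
def InPermSet {n d : ℕ} (X Y : Fin n → Fin d → ℝ) : Prop :=
  ∀ i : Fin d, ∃ π : Equiv.Perm (Fin n), ∀ k, Y k i = X (π k) i

/-- `x` and `y` are oppositely ordered. -/
def OppOrd {n : ℕ} (x y : Fin n → ℝ) : Prop :=
  ∀ k l, (x k - x l) * (y k - y l) ≤ 0

/-- Supermodularity for functions of two real variables. -/
def Supermod2 (h : ℝ → ℝ → ℝ) : Prop :=
  ∀ a a' b b', h a b + h a' b' ≤ h (min a a') (min b b') + h (max a a') (max b b')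

/-- Supermodularity for functions on `ℝ^m`. -/
def SupermodPi {m : ℕ} (h : (Fin m → ℝ) → ℝ) : Prop :=
  ∀ x y, h x + h y ≤ h (x ⊓ y) + h (x ⊔ y)

/-- `h` is strictly monotone in each component. -/
def StrictCompMono {m : ℕ} (h : (Fin m → ℝ) → ℝ) : Prop :=
  ∀ i : Fin m,
    (∀ x : Fin m → ℝ, StrictMono fun t => h (Function.update x i t)) ∨
    (∀ x : Fin m → ℝ, StrictAnti fun t => h (Function.update x i t))

/-- A nondecreasing vector which is dominated by a rearrangement of a nondecreasing vector `a`
is dominated by `a`. -/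
theorem Monotone.le_of_le_comp_perm {n : ℕ} {g a : Fin n → ℝ} (hg : Monotone g) (ha : Monotone a)
    (ρ : Equiv.Perm (Fin n)) (h : ∀ i, g i ≤ a (ρ i)) (j : Fin n) : g j ≤ a j := by
  obtain ⟨i, hji, hij⟩ : ∃ i, j ≤ i ∧ ρ i ≤ j := by
    by_contra! hlt
    have hcard : (Finset.Ici j).card ≤ (Finset.Ioi j).card :=
      Finset.card_le_card_of_injOn ρ
        (fun i hi => by simpa using hlt i (by simpa using hi)) ρ.injective.injOn
    simp only [Fin.card_Ici, Fin.card_Ioi] at hcard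
    omega
  exact (hg hji).trans ((h i).trans (ha hij))

/-- Among all pairings of the entries of two vectors, the similarly ordered one maximizes the sum
of the pairwise minima. -/
theorem sum_min_comp_perm_le {n : ℕ} {a c : Fin n → ℝ} (ha : Monotone a) (hc : Monotone c)
    (σ τ : Equiv.Perm (Fin n)) :
    ∑ i, min (a (σ i)) (c (τ i)) ≤ ∑ i, min (a i) (c i) := by
  set e : Fin n → ℝ := fun i => min (a (σ i)) (c (τ i))
  have hmono : Monotone (e ∘ Tuple.sort e) := Tuple.monotone_sort e
  rw [← Equiv.sum_comp (Tuple.sort e) e]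
  refine Finset.sum_le_sum fun j _ => le_min ?_ ?_
  · exact hmono.le_of_le_comp_perm ha ((Tuple.sort e).trans σ) (fun i => min_le_left _ _) j
  · exact hmono.le_of_le_comp_perm hc ((Tuple.sort e).trans τ) (fun i => min_le_right _ _) j

theorem antitone_decSort {n : ℕ} (x : Fin n → ℝ) : Antitone (decSort x) :=
  fun _ _ hij => Tuple.monotone_sort x (Fin.rev_le_rev.mpr hij)

theorem monotone_incSort {n : ℕ} (x : Fin n → ℝ) : Monotone (incSort x) :=
  Tuple.monotone_sort x

theorem sum_comp_decSort {n : ℕ} (f : ℝ → ℝ) (x : Fin n → ℝ) :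
    ∑ i, f (decSort x i) = ∑ i, f (x i) :=
  Equiv.sum_comp (Fin.revPerm.trans (Tuple.sort x)) fun i => f (x i)

theorem card_filter_val_lt {n k : ℕ} (hk : k ≤ n) :
    (Finset.univ.filter fun i : Fin n => (i : ℕ) < k).card = k := by
  rw [Fin.card_filter_val_lt, min_eq_right hk]

theorem topSum_le_sum_posPart {n k : ℕ} (hk : k ≤ n) (z : Fin n → ℝ) (t : ℝ) :
    topSum k z ≤ ∑ i, max (z i - t) 0 + k * t := by
  calc topSum k z
      ≤ ∑ i ∈ Finset.univ.filter (fun i : Fin n => (i : ℕ) < k),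
          (max (decSort z i - t) 0 + t) :=
        Finset.sum_le_sum fun i _ => by linarith [le_max_left (decSort z i - t) 0]
    _ = ∑ i ∈ Finset.univ.filter (fun i : Fin n => (i : ℕ) < k),
          max (decSort z i - t) 0 + k * t := by
        rw [Finset.sum_add_distrib, Finset.sum_const, card_filter_val_lt hk, nsmul_eq_mul]
    _ ≤ ∑ i, max (decSort z i - t) 0 + k * t := by
        exact add_le_add (Finset.sum_le_univ_sum_of_nonneg fun i => le_max_right _ _) le_rfl
    _ = ∑ i, max (z i - t) 0 + k * t := by
        rw [sum_comp_decSort fun s => max (s - t) 0]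

theorem topSum_eq_sum_posPart {n k : ℕ} (hk : k < n) (z : Fin n → ℝ) :
    topSum k z = ∑ i, max (z i - decSort z ⟨k, hk⟩) 0 + k * decSort z ⟨k, hk⟩ := by
  set t := decSort z ⟨k, hk⟩
  have hsum : ∑ i, max (decSort z i - t) 0 =
      ∑ i ∈ Finset.univ.filter (fun i : Fin n => (i : ℕ) < k), (decSort z i - t) := by
    rw [Finset.sum_filter]
    refine Finset.sum_congr rfl fun i _ => ?_
    split_ifs with hi
    · exact max_eq_left (sub_nonneg.mpr (antitone_decSort z (Fin.mk_le_mk.mpr hi.le)))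
    · exact max_eq_right (sub_nonpos.mpr (antitone_decSort z (Fin.mk_le_mk.mpr (not_lt.mp hi))))
  rw [← sum_comp_decSort fun s => max (s - t) 0, hsum, Finset.sum_sub_distrib, Finset.sum_const,
    card_filter_val_lt hk.le, nsmul_eq_mul, topSum]
  ring

/-- The sum of two oppositely ordered vectors is majorized by the sum of any of their
rearrangements. -/
theorem maj_add_of_monotone_of_antitone {n : ℕ} {a b : Fin n → ℝ} (ha : Monotone a)
    (hb : Antitone b) (ρ σ τ : Equiv.Perm (Fin n)) :
    Maj (fun i => a (ρ i) + b (ρ i)) (fun i => a (σ i) + b (τ i)) := by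
  refine ⟨fun k hk => ?_, ?_⟩
  · rw [topSum_eq_sum_posPart hk fun i => a (σ i) + b (τ i)]
    set t := decSort (fun i => a (σ i) + b (τ i)) ⟨k, hk⟩
    refine (topSum_le_sum_posPart hk.le _ t).trans ?_
    have hmin := sum_min_comp_perm_le (c := fun i => t - b i) ha
      (fun _ _ hij => sub_le_sub_left (hb hij) t) σ τ
    have hmax (u v : ℝ) : max (u + v - t) 0 = u - min u (t - v) := by
      rcases le_total u (t - v) with h | h
      · rw [min_eq_left h, max_eq_right (by linarith), sub_self]
      · rw [min_eq_right h, max_eq_left (by linarith)]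
        ring
    rw [Equiv.sum_comp ρ fun i => max (a i + b i - t) 0]
    simp only [hmax, Finset.sum_sub_distrib, Equiv.sum_comp σ a]
    linarith
  · simp only [Finset.sum_add_distrib, Equiv.sum_comp]

/-- 6.B.2 in Marshall–Olkin, "if" direction: if `h(x₁,x₂) = φ₁(x₁)+φ₂(x₂)`
with `φ₁, φ₂` monotone in the same direction, then the oppositely-ordered aggregation is
(strongly) majorized by the original. -/
theorem stmt11 {n : ℕ} (h : ℝ → ℝ → ℝ) (φ1 φ2 : ℝ → ℝ)
    (hform : ∀ a b, h a b = φ1 a + φ2 b)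
    (hdir : (Monotone φ1 ∧ Monotone φ2) ∨ (Antitone φ1 ∧ Antitone φ2))
    (x y : Fin n → ℝ) :
    Maj (fun i => h (decSort x i) (incSort y i)) (fun i => h (x i) (y i)) := by
  simp only [hform]
  rcases hdir with ⟨h1, h2⟩ | ⟨h1, h2⟩
  · simpa [decSort, incSort] using maj_add_of_monotone_of_antitone
      (h1.comp (monotone_incSort x)) (h2.comp_antitone (antitone_decSort y))
      Fin.revPerm (Tuple.sort x).symm ((Tuple.sort y).symm.trans Fin.revPerm)
  · simpa [decSort, incSort] using maj_add_of_monotone_of_antitone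
      (h1.comp (antitone_decSort x)) (h2.comp_monotone (monotone_incSort y))
      (Equiv.refl _) ((Tuple.sort x).symm.trans Fin.revPerm) (Tuple.sort y).symm
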